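/- Let Y ⊆ ℝ^{d₂} be a nonempty closed convex set, μ, L > 0 with μ ≤ L, and let g : ℝ^{d₁} × ℝ^{d₂} → ℝ be such that for each x the map y ↦ g(x,y) is differentiable, μ-strongly convex, and has L-Lipschitz gradient in y; let y*(x) denote the unique minimizer of g(x,·) over Y, and assume the map x ↦ y*(x) is L_y-Lipschitz. Let x, x' ∈ ℝ^{d₁}, y ∈ Y, v ∈ ℝ^{d₂}, and let s, η satisfy 0 < s ≤ 1/(6L) and 0 < η ≤ 1. Define ỹ = P_Y(y − s·v) and y⁺ = (1 − η)y + η·ỹ. Then ‖y⁺ − y*(x')‖² ≤ (1 − ημs/4)‖y − y*(x)‖² + (25ηs/(6μ))‖∇_y g(x,y) − v‖² − (3η/4)‖ỹ − y‖² + (25·L_y²/(6ημs))‖x − x'‖². -/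

import Mathlib

open Set

open scoped RealInnerProductSpace in
lemma ConvexOn.inner_gradient_add_le_of_sub_sq {E : Type*} [NormedAddCommGroup E]
    [InnerProductSpace ℝ E] [CompleteSpace E] {f : E → ℝ} {m : ℝ} {a : E}
    (hf : DifferentiableAt ℝ f a)
    (hc : ConvexOn ℝ univ (fun y => f y - m / 2 * ‖y‖ ^ 2)) (b : E) :
    f a + ⟪gradient f a, b - a⟫ + m / 2 * ‖b - a‖ ^ 2 ≤ f b := by
  have hline : HasDerivAt (fun t : ℝ => AffineMap.lineMap a b t) (b - a) (0 : ℝ) :=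
    AffineMap.hasDerivAt_lineMap
  have hf' : HasFDerivAt f (InnerProductSpace.toDual ℝ E (gradient f a))
      (AffineMap.lineMap a b (0 : ℝ)) := by
    simpa using hf.hasGradientAt.hasFDerivAt
  have hd := (hf'.comp_hasDerivAt (0 : ℝ) hline).sub (hline.norm_sq.const_mul (m / 2))
  have h := (hc.comp_affineMap (AffineMap.lineMap a b)).le_slope_of_hasDerivAt
    (mem_univ 0) (mem_univ 1) one_pos hd
  have hsq := norm_add_sq_real a (b - a)
  simp only [AffineMap.lineMap_apply_zero, InnerProductSpace.toDual_apply_apply,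
    slope_def_field, Function.comp_apply, AffineMap.lineMap_apply_one, sub_zero, div_one] at h
  rw [add_sub_cancel] at hsq
  rw [hsq] at h
  linarith

open scoped RealInnerProductSpace in
lemma Differentiable.le_add_inner_gradient_add_sq {E : Type*} [NormedAddCommGroup E]
    [InnerProductSpace ℝ E] [CompleteSpace E] {f : E → ℝ} {L : ℝ}
    (hf : Differentiable ℝ f)
    (hL : ∀ a b, ‖gradient f a - gradient f b‖ ≤ L * ‖a - b‖) (a b : E) :
    f b ≤ f a + ⟪gradient f a, b - a⟫ + L / 2 * ‖b - a‖ ^ 2 := by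
  have hline (t : ℝ) : HasDerivAt (fun t : ℝ => AffineMap.lineMap a b t) (b - a) t :=
    AffineMap.hasDerivAt_lineMap
  have hd (t : ℝ) : HasDerivAt (fun t : ℝ => f (AffineMap.lineMap a b t))
      ⟪gradient f (AffineMap.lineMap a b t), b - a⟫ t :=
    (hf _).hasGradientAt.hasFDerivAt.comp_hasDerivAt t (hline t)
  have hB (t : ℝ) : HasDerivAt
      (fun t : ℝ => f a + t * ⟪gradient f a, b - a⟫ + t ^ 2 * (L / 2 * ‖b - a‖ ^ 2))
      (⟪gradient f a, b - a⟫ + t * (L * ‖b - a‖ ^ 2)) t := by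
    have := (((hasDerivAt_id t).mul_const ⟪gradient f a, b - a⟫).const_add (f a)).add
      ((hasDerivAt_pow 2 t).mul_const (L / 2 * ‖b - a‖ ^ 2))
    refine this.congr_deriv ?_
    push_cast
    ring
  have h := image_le_of_deriv_right_le_deriv_boundary (a := 0) (b := 1)
    (fun t _ => (hd t).continuousAt.continuousWithinAt)
    (fun t _ => (hd t).hasDerivWithinAt) (by simp)
    (fun t _ => (hB t).continuousAt.continuousWithinAt)
    (fun t _ => (hB t).hasDerivWithinAt)
    (fun t ht => by
      have h1 := real_inner_le_norm
        (gradient f (AffineMap.lineMap a b t) - gradient f a) (b - a)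
      have h2 := mul_le_mul_of_nonneg_right (hL (AffineMap.lineMap a b t) a)
        (norm_nonneg (b - a))
      have h3 : ‖AffineMap.lineMap a b t - a‖ = t * ‖b - a‖ := by
        simp [AffineMap.lineMap_apply, norm_smul, abs_of_nonneg ht.1]
      rw [inner_sub_left] at h1
      rw [h3] at h2
      linarith)
    (right_mem_Icc.2 zero_le_one)
  simpa using h

open scoped RealInnerProductSpace in
lemma Convex.inner_sub_le_zero_of_forall_norm_sub_le {E : Type*} [NormedAddCommGroup E]
    [InnerProductSpace ℝ E] {Y : Set E} (hY : Convex ℝ Y) {u p : E} (hp : p ∈ Y)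
    (hmin : ∀ z ∈ Y, ‖u - p‖ ≤ ‖u - z‖) {z : E} (hz : z ∈ Y) :
    ⟪u - p, z - p⟫ ≤ 0 := by
  have : Nonempty Y := ⟨⟨p, hp⟩⟩
  refine (norm_eq_iInf_iff_real_inner_le_zero hY hp).1 (le_antisymm ?_ ?_) z hz
  · exact le_ciInf fun w => hmin w w.2
  · exact ciInf_le ⟨0, by rintro _ ⟨w, rfl⟩; exact norm_nonneg _⟩ (⟨p, hp⟩ : Y)

open scoped RealInnerProductSpace in
lemma two_mul_inner_le_mul_sq_add_sq_div {E : Type*} [NormedAddCommGroup E]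
    [InnerProductSpace ℝ E] (a b : E) {c : ℝ} (hc : 0 < c) :
    2 * ⟪a, b⟫ ≤ c * ‖a‖ ^ 2 + ‖b‖ ^ 2 / c := by
  have h := real_inner_le_norm a b
  have h' : c * ‖a‖ ^ 2 + ‖b‖ ^ 2 / c - 2 * (‖a‖ * ‖b‖) = (c * ‖a‖ - ‖b‖) ^ 2 / c := by
    field_simp
    ring
  have : 0 ≤ (c * ‖a‖ - ‖b‖) ^ 2 / c := by positivity
  linarith

open scoped RealInnerProductSpace in
/-- One inexact projected gradient step contracts the distance to the constrained minimizer `u`. -/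
lemma norm_projected_gradient_step_sub_sq_le {E : Type*} [NormedAddCommGroup E]
    [InnerProductSpace ℝ E] [CompleteSpace E] {Y : Set E} (hY : Convex ℝ Y)
    {μ L : ℝ} (hμ : 0 < μ) (hL : 0 < L) (hμL : μ ≤ L) {f : E → ℝ} (hf : Differentiable ℝ f)
    (hsc : ConvexOn ℝ univ (fun y => f y - μ / 2 * ‖y‖ ^ 2))
    (hgrad : ∀ a b, ‖gradient f a - gradient f b‖ ≤ L * ‖a - b‖)
    {u y v p : E} (hu : u ∈ Y) (hmin : ∀ z ∈ Y, f u ≤ f z) {s η : ℝ}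
    (hs : 0 < s) (hs' : s ≤ 1 / (6 * L)) (hη : 0 < η) (hη' : η ≤ 1) (hp : p ∈ Y)
    (hproj : ∀ z ∈ Y, ‖(y - s • v) - p‖ ≤ ‖(y - s • v) - z‖) :
    ‖((1 - η) • y + η • p) - u‖ ^ 2 ≤ (1 - η * μ * s / 2) * ‖y - u‖ ^ 2 +
      (4 * η * s / μ) * ‖gradient f y - v‖ ^ 2 - (3 * η / 4) * ‖p - y‖ ^ 2 := by
  have hsL : s * L ≤ 1 / 6 := by
    rw [le_div_iff₀ (by positivity)] at hs'
    linarith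
  have hsμ : s * μ ≤ 1 / 6 := (mul_le_mul_of_nonneg_left hμL hs.le).trans hsL
  have h1 := hsc.inner_gradient_add_le_of_sub_sq (hf y) u
  have h2 := hf.le_add_inner_gradient_add_sq hgrad y p
  have h3 := hmin p hp
  have h4 := hY.inner_sub_le_zero_of_forall_norm_sub_le hp hproj hu
  have hc : 0 < μ / 2 := by positivity
  have h5 := two_mul_inner_le_mul_sq_add_sq_div (y - u) (gradient f y - v) hc
  have h6 := two_mul_inner_le_mul_sq_add_sq_div (p - y) (gradient f y - v) hc
  obtain ⟨e, he⟩ : ∃ e, e = y - u := ⟨_, rfl⟩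
  obtain ⟨d, hd⟩ : ∃ d, d = p - y := ⟨_, rfl⟩
  obtain ⟨w, hw⟩ : ∃ w, w = gradient f y - v := ⟨_, rfl⟩
  have hG : gradient f y = w + v := by rw [hw]; abel
  rw [show (1 - η) • y + η • p - u = e + η • d by rw [he, hd]; module, norm_add_sq_real,
    norm_smul, inner_smul_right, Real.norm_of_nonneg hη.le, ← he, ← hd, ← hw]
  rw [show u - y = -e by rw [he]; abel, norm_neg, inner_neg_right, hG, inner_add_left] at h1
  rw [← hd, hG, inner_add_left] at h2
  rw [show y - s • v - p = -(s • v + d) by rw [hd]; abel,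
    show u - p = -(e + d) by rw [he, hd]; abel, inner_neg_neg, inner_add_left,
    inner_smul_left, inner_add_right, inner_add_right, real_inner_self_eq_norm_sq,
    real_inner_comm e d] at h4
  simp only [conj_trivial] at h4
  rw [← he, ← hw, real_inner_comm] at h5
  rw [← hd, ← hw, real_inner_comm] at h6
  have hdiv : ‖w‖ ^ 2 / (μ / 2) = 2 * (‖w‖ ^ 2 / μ) := by field_simp
  have hdiv' : 4 * η * s / μ * ‖w‖ ^ 2 = 4 * (η * s) * (‖w‖ ^ 2 / μ) := by ring
  rw [hdiv] at h5 h6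
  rw [hdiv']
  have h7 := mul_le_mul_of_nonneg_left (add_le_add (add_le_add h1 h2) h3)
    (show 0 ≤ 2 * η * s by positivity)
  have h8 := mul_le_mul_of_nonneg_left h4 (show 0 ≤ 2 * η by positivity)
  have h9 := mul_le_mul_of_nonneg_left (add_le_add h5 h6) (show 0 ≤ η * s by positivity)
  have h10 := mul_le_mul_of_nonneg_right hsL (show 0 ≤ η * ‖d‖ ^ 2 by positivity)
  have h11 := mul_le_mul_of_nonneg_right hsμ (show 0 ≤ η * ‖d‖ ^ 2 by positivity)
  have h12 := mul_le_mul_of_nonneg_right hη' (show 0 ≤ η * ‖d‖ ^ 2 by positivity)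
  linarith

/-- Tracking error of the inexact projected gradient update of the
lower-level variable when the upper-level variable moves from `x` to `x'`: with
`ỹ = P_Y(y − s·v)` and `y⁺ = (1 − η)y + η·ỹ`,
`‖y⁺ − y*(x')‖² ≤ (1 − ημs/4)‖y − y*(x)‖² + (25ηs/(6μ))‖∇_y g(x,y) − v‖²
  − (3η/4)‖ỹ − y‖² + (25·L_y²/(6ημs))‖x − x'‖²`. -/
theorem projected_gradient_tracking_error {d₁ d₂ : ℕ}
    (Y : Set (EuclideanSpace ℝ (Fin d₂))) (hYne : Y.Nonempty) (hYclosed : IsClosed Y)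
    (hYconv : Convex ℝ Y)
    (μ L : ℝ) (hμ : 0 < μ) (hL : 0 < L) (hμL : μ ≤ L)
    (g : EuclideanSpace ℝ (Fin d₁) → EuclideanSpace ℝ (Fin d₂) → ℝ)
    (hg : ∀ x, Differentiable ℝ (g x))
    (hsc : ∀ x, ConvexOn ℝ univ (fun y => g x y - μ / 2 * ‖y‖ ^ 2))
    (hgrad : ∀ x a b, ‖gradient (g x) a - gradient (g x) b‖ ≤ L * ‖a - b‖)
    (ystar : EuclideanSpace ℝ (Fin d₁) → EuclideanSpace ℝ (Fin d₂))
    (hystar : ∀ x, ystar x ∈ Y ∧ ∀ y' ∈ Y, g x (ystar x) ≤ g x y')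
    (Ly : NNReal) (hystarLip : LipschitzWith Ly ystar)
    (x x' : EuclideanSpace ℝ (Fin d₁))
    (y : EuclideanSpace ℝ (Fin d₂)) (hy : y ∈ Y)
    (v : EuclideanSpace ℝ (Fin d₂)) (s η : ℝ)
    (hs : 0 < s) (hs' : s ≤ 1 / (6 * L)) (hη : 0 < η) (hη' : η ≤ 1)
    (ytil : EuclideanSpace ℝ (Fin d₂))
    (hytil : ytil ∈ Y ∧ ∀ y' ∈ Y, ‖(y - s • v) - ytil‖ ≤ ‖(y - s • v) - y'‖) :
    ‖((1 - η) • y + η • ytil) - ystar x'‖ ^ 2 ≤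
      (1 - η * μ * s / 4) * ‖y - ystar x‖ ^ 2 +
        (25 * η * s / (6 * μ)) * ‖gradient (g x) y - v‖ ^ 2 -
        (3 * η / 4) * ‖ytil - y‖ ^ 2 +
        (25 * (Ly : ℝ) ^ 2 / (6 * η * μ * s)) * ‖x - x'‖ ^ 2 := by
  have hstep := norm_projected_gradient_step_sub_sq_le hYconv hμ hL hμL (hg x) (hsc x) (hgrad x)
    (hystar x).1 (hystar x).2 hs hs' hη hη' hytil.1 hytil.2
  have hsμ : s * μ ≤ 1 / 6 := by
    rw [le_div_iff₀ (by positivity)] at hs'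
    have := mul_le_mul_of_nonneg_left hμL hs.le
    linarith
  have hk : 0 < η * μ * s := by positivity
  have hk' : η * μ * s ≤ 1 / 6 := by
    have := mul_le_mul_of_nonneg_right hη' (show 0 ≤ s * μ by positivity)
    linarith
  have hLip : ‖ystar x - ystar x'‖ ^ 2 ≤ (Ly : ℝ) ^ 2 * ‖x - x'‖ ^ 2 := by
    rw [← mul_pow]
    exact pow_le_pow_left₀ (norm_nonneg _) (hystarLip.norm_sub_le x x') 2
  have hyoung := two_mul_inner_le_mul_sq_add_sq_div
    ((1 - η) • y + η • ytil - ystar x) (ystar x - ystar x')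
    (show 0 < η * μ * s / 4 by positivity)
  rw [← sub_add_sub_cancel _ (ystar x) (ystar x'), norm_add_sq_real]
  have hW : 25 * η * s / (6 * μ) * ‖gradient (g x) y - v‖ ^ 2 =
      25 / 24 * (4 * η * s / μ * ‖gradient (g x) y - v‖ ^ 2) := by
    ring
  have hW0 : 0 ≤ 4 * η * s / μ * ‖gradient (g x) y - v‖ ^ 2 := by positivity
  have hQ : ‖ystar x - ystar x'‖ ^ 2 + ‖ystar x - ystar x'‖ ^ 2 / (η * μ * s / 4) ≤
      25 * (Ly : ℝ) ^ 2 / (6 * η * μ * s) * ‖x - x'‖ ^ 2 := by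
    have h : 1 + 4 / (η * μ * s) ≤ 25 / (6 * (η * μ * s)) := by
      rw [← sub_nonneg]
      have : 25 / (6 * (η * μ * s)) - (1 + 4 / (η * μ * s)) =
          (1 / 6 - η * μ * s) / (η * μ * s) := by
        field_simp
        ring
      rw [this]
      exact div_nonneg (by linarith) hk.le
    calc _ = (1 + 4 / (η * μ * s)) * ‖ystar x - ystar x'‖ ^ 2 := by field_simp
      _ ≤ 25 / (6 * (η * μ * s)) * ((Ly : ℝ) ^ 2 * ‖x - x'‖ ^ 2) := by gcongr
      _ = _ := by field_simp
  rw [hW]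
  generalize 4 * η * s / μ * ‖gradient (g x) y - v‖ ^ 2 = W at *
  have hmul := mul_le_mul_of_nonneg_left hstep (show 0 ≤ 1 + η * μ * s / 4 by positivity)
  have hWk := mul_le_mul_of_nonneg_right hk' hW0
  have hE : 0 ≤ (η * μ * s) ^ 2 * ‖y - ystar x‖ ^ 2 := by positivity
  have hD : 0 ≤ η * μ * s * (η * ‖ytil - y‖ ^ 2) := by positivity
  linarith
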